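/- arXiv:1205.1595 — 2 statements merged into one kernel-verified Lean document; each statement's English description precedes it below -/
import Mathlib

section
/- Lower tail bound: let t > 0 and W = ‖ Σ_{k=1}^n E_k[ (f − inf_k f)² ] ‖_∞. Then μ{x : E[f] − f(x) > t} ≤ exp( −t² / (2W) ). -/
open MeasureTheory Real

section ProductSpace

variable {n : ℕ} {Ω : Fin n → Type*} [∀ k, MeasurableSpace (Ω k)]

/-- Thermal expectation `E_{βf}[g] = E[g e^{βf}] / E[e^{βf}]`. -/
noncomputable def thermalExp {α : Type*} [MeasurableSpace α] (ν : Measure α)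
    (β : ℝ) (f g : α → ℝ) : ℝ :=
  (∫ x, g x * Real.exp (β * f x) ∂ν) / ∫ x, Real.exp (β * f x) ∂ν

/-- Canonical entropy `S_f(β) = β E_{βf}[f] − ln Z_{βf}`. -/
noncomputable def canEntropy {α : Type*} [MeasurableSpace α] (ν : Measure α)
    (f : α → ℝ) (β : ℝ) : ℝ :=
  β * thermalExp ν β f f - Real.log (∫ x, Real.exp (β * f x) ∂ν)

/-- Conditional expectation `E_k[g](x) = ∫ g(x_{y,k}) dμ_k(y)`. -/
noncomputable def condExpK (μ : ∀ k, Measure (Ω k)) (k : Fin n)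
    (g : (∀ i, Ω i) → ℝ) (x : ∀ i, Ω i) : ℝ :=
  ∫ y, g (Function.update x k y) ∂(μ k)

/-- Conditional thermal expectation `E_{k,βf}[g](x) = E_k[g e^{βf}](x) / E_k[e^{βf}](x)`. -/
noncomputable def condThermalExpK (μ : ∀ k, Measure (Ω k)) (k : Fin n) (β : ℝ)
    (f g : (∀ i, Ω i) → ℝ) (x : ∀ i, Ω i) : ℝ :=
  (∫ y, g (Function.update x k y) * Real.exp (β * f (Function.update x k y)) ∂(μ k)) /
    ∫ y, Real.exp (β * f (Function.update x k y)) ∂(μ k)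

/-- Conditional entropy `S_{k,f}(β)(x) = β E_{k,βf}[f](x) − ln Z_{k,βf}(x)`. -/
noncomputable def condEntropyK (μ : ∀ k, Measure (Ω k)) (k : Fin n)
    (f : (∀ i, Ω i) → ℝ) (β : ℝ) (x : ∀ i, Ω i) : ℝ :=
  β * condThermalExpK μ k β f f x -
    Real.log (∫ y, Real.exp (β * f (Function.update x k y)) ∂(μ k))

/-- Conditional variance `σ²_k[g](x) = E_k[(g − E_k[g])²](x)`. -/
noncomputable def condVarK (μ : ∀ k, Measure (Ω k)) (k : Fin n)
    (g : (∀ i, Ω i) → ℝ) (x : ∀ i, Ω i) : ℝ :=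
  ∫ y, (g (Function.update x k y) - condExpK μ k g x) ^ 2 ∂(μ k)

/-- Conditional supremum `(sup_k g)(x) = sup_{y} g(x_{y,k})`. -/
noncomputable def condSupK (k : Fin n) (g : (∀ i, Ω i) → ℝ) (x : ∀ i, Ω i) : ℝ :=
  ⨆ y : Ω k, g (Function.update x k y)

/-- Conditional infimum `(inf_k g)(x) = inf_{y} g(x_{y,k})`. -/
noncomputable def condInfK (k : Fin n) (g : (∀ i, Ω i) → ℝ) (x : ∀ i, Ω i) : ℝ :=
  ⨅ y : Ω k, g (Function.update x k y)

/-- Worst-case variance proxy `Dg = Σ_k (g − inf_k g)²`. -/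
noncomputable def Dproxy (g : (∀ i, Ω i) → ℝ) (x : ∀ i, Ω i) : ℝ :=
  ∑ k, (g x - condInfK k g x) ^ 2

end ProductSpace
section Helpers1

open ProbabilityTheory

lemma h_bdd_int {α : Type*} [MeasurableSpace α] (ν : Measure α) [IsFiniteMeasure ν]
    {g : α → ℝ} (hg : Measurable g) {b : ℝ} (hb : ∀ x, |g x| ≤ b) : Integrable g ν :=
  Integrable.of_bound hg.aestronglyMeasurable b (Filter.Eventually.of_forall (by simpa using hb))

lemma h_expSet {α : Type*} [MeasurableSpace α] (ν : Measure α) [IsFiniteMeasure ν]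
    {X : α → ℝ} (hX : Measurable X) {C : ℝ} (hC : ∀ x, |X x| ≤ C) :
    integrableExpSet X ν = Set.univ := by
  ext s
  simp only [integrableExpSet, Set.mem_ofPred_eq, Set.mem_univ, iff_true]
  refine h_bdd_int ν (by fun_prop) (b := Real.exp (|s| * C)) (fun x => ?_)
  rw [abs_of_pos (Real.exp_pos _), Real.exp_le_exp]
  calc s * X x ≤ |s * X x| := le_abs_self _
    _ = |s| * |X x| := abs_mul _ _
    _ ≤ |s| * C := by gcongr; exact hC x

lemma h_assoc {α : Type*} [MeasurableSpace α] (ν : Measure α) [IsProbabilityMeasure ν]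
    {X : α → ℝ} (hX : Measurable X) {C : ℝ} (hC : ∀ x, |X x| ≤ C) {m : ℝ}
    (hm : ∀ x, X x ≤ m) {s : ℝ} (hs : 0 ≤ s) :
    ∫ x, (X x - m) ^ 2 * Real.exp (s * X x) ∂ν
      ≤ (∫ x, (X x - m) ^ 2 ∂ν) * mgf X ν s := by
  set c := ∫ x, (X x - m) ^ 2 ∂ν with hc
  have hc0 : 0 ≤ c := integral_nonneg (fun x => sq_nonneg _)
  have hexp : ∀ s, Integrable (fun x => Real.exp (s * X x)) ν := fun s => by
    have : s ∈ integrableExpSet X ν := by simp [h_expSet ν hX hC]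
    exact this
  have hsq : ∀ x, |(X x - m) ^ 2| ≤ (C + |m|) ^ 2 := fun x => by
    rw [abs_pow]
    gcongr
    exact (abs_sub _ _).trans (by gcongr; exact hC x)
  have hsqi : Integrable (fun x => (X x - m) ^ 2) ν := h_bdd_int ν (by fun_prop) hsq
  have hprod : Integrable (fun x => (X x - m) ^ 2 * Real.exp (s * X x)) ν :=
    (hexp s).bdd_mul (c := (C + |m|) ^ 2) (by fun_prop)
      (Filter.Eventually.of_forall (by simpa only [Real.norm_eq_abs] using hsq))
  set q := Real.exp (s * (m - √c)) with hq
  have key : ∀ x, (X x - m) ^ 2 * Real.exp (s * X x) ≤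
      c * Real.exp (s * X x) + q * (X x - m) ^ 2 - q * c := by
    intro x
    have : ((X x - m) ^ 2 - c) * (Real.exp (s * X x) - q) ≤ 0 := by
      have hsc := Real.sq_sqrt hc0
      have hs0 := Real.sqrt_nonneg c
      rcases le_total (X x) (m - √c) with h | h
      · apply mul_nonpos_of_nonneg_of_nonpos
        · nlinarith [hm x]
        · rw [sub_nonpos, hq, Real.exp_le_exp]; gcongr
      · apply mul_nonpos_of_nonpos_of_nonneg
        · nlinarith [hm x]
        · rw [sub_nonneg, hq, Real.exp_le_exp]; gcongr
    linarith
  have h1 := integral_mono hprod (((hexp s).const_mul c).add (hsqi.const_mul q) |>.sub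
    (integrable_const (q * c))) key
  refine h1.trans (le_of_eq ?_)
  rw [integral_sub' (((hexp s).const_mul c).add (hsqi.const_mul q)) (integrable_const _)]
  rw [integral_add' ((hexp s).const_mul c) (hsqi.const_mul q), integral_const_mul,
    integral_const_mul, ← hc, mgf]
  simp

lemma h_fiber {α : Type*} [MeasurableSpace α] (ν : Measure α) [IsProbabilityMeasure ν]
    {X : α → ℝ} (hX : Measurable X) {C : ℝ} (hC : ∀ x, |X x| ≤ C) {m : ℝ}
    (hm : ∀ x, X x ≤ m) {s : ℝ} (hs : 0 ≤ s) :
    s * ((∫ x, X x * Real.exp (s * X x) ∂ν) / mgf X ν s) - cgf X ν s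
      ≤ s ^ 2 / 2 * ∫ x, (X x - m) ^ 2 ∂ν := by
  have hint : ∀ s, s ∈ interior (integrableExpSet X ν) := fun s => by
    simp [h_expSet ν hX hC]
  have hexp : ∀ s, Integrable (fun x => Real.exp (s * X x)) ν := fun s => by
    have : s ∈ integrableExpSet X ν := by simp [h_expSet ν hX hC]
    exact this
  set c := ∫ x, (X x - m) ^ 2 ∂ν with hc
  rw [← deriv_cgf (hint s)]
  have hvar : ∀ s, 0 ≤ s → iteratedDeriv 2 (cgf X ν) s ≤ c := by
    intro s hs
    have : IsProbabilityMeasure (ν.tilted (s * X ·)) := isProbabilityMeasure_tilted (hexp s)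
    rw [← variance_tilted_mul (hint s), ← variance_sub_const (by fun_prop) m]
    refine (variance_le_expectation_sq (by fun_prop)).trans ?_
    rw [integral_tilted_mul_eq_mgf]
    have hZ : 0 < mgf X ν s := mgf_pos (hexp s)
    have := h_assoc ν hX hC hm hs
    rw [← hc, ← div_le_iff₀ hZ, ← integral_div] at this
    refine le_trans (le_of_eq ?_) this
    congr with x
    simp
    ring
  have hd1 : ∀ s, HasDerivAt (cgf X ν) (deriv (cgf X ν) s) s := fun s =>
    (analyticAt_cgf (hint s)).differentiableAt.hasDerivAt
  have hd2 : ∀ s, HasDerivAt (deriv (cgf X ν)) (iteratedDeriv 2 (cgf X ν) s) s := fun s => by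
    rw [iteratedDeriv_succ, iteratedDeriv_one]
    exact (analyticAt_cgf (hint s)).deriv.differentiableAt.hasDerivAt
  have hd : ∀ s, HasDerivAt (fun s => s * deriv (cgf X ν) s - cgf X ν s - s ^ 2 / 2 * c)
      (s * (iteratedDeriv 2 (cgf X ν) s - c)) s := fun s => by
    have := (((hasDerivAt_id s).mul (hd2 s)).sub (hd1 s)).sub
      ((((hasDerivAt_id s).pow 2).div_const 2).mul_const c)
    refine this.congr_deriv ?_
    simp only [id, one_mul, mul_one, Nat.cast_ofNat, Nat.add_one_sub_one, pow_one]
    ring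
  have hanti := antitoneOn_of_deriv_nonpos (convex_Ici (0:ℝ))
    (fun s _ => (hd s).continuousAt.continuousWithinAt)
    (fun s _ => (hd s).differentiableAt.differentiableWithinAt)
    (fun s hs' => by
      rw [interior_Ici] at hs'
      rw [(hd s).deriv]
      have := hvar s (le_of_lt hs')
      exact mul_nonpos_of_nonneg_of_nonpos (le_of_lt hs') (by linarith))
  have := hanti (Set.mem_Ici.2 le_rfl) (Set.mem_Ici.2 hs) hs
  simp at this
  linarith

lemma h_herbst {α : Type*} [MeasurableSpace α] (ν : Measure α) [IsProbabilityMeasure ν]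
    {X : α → ℝ} (hX : Measurable X) {C : ℝ} (hC : ∀ x, |X x| ≤ C) {W : ℝ}
    (h : ∀ s, 0 < s → s * ((∫ x, X x * Real.exp (s * X x) ∂ν) / mgf X ν s) - cgf X ν s
      ≤ s ^ 2 / 2 * W) {s : ℝ} (hs : 0 < s) :
    cgf X ν s ≤ s * (∫ x, X x ∂ν) + s ^ 2 / 2 * W := by
  have hint : ∀ s, s ∈ interior (integrableExpSet X ν) := fun s => by
    simp [h_expSet ν hX hC]
  have hd1 : ∀ s, HasDerivAt (cgf X ν) (deriv (cgf X ν) s) s := fun s =>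
    (analyticAt_cgf (hint s)).differentiableAt.hasDerivAt
  have hd : ∀ s : ℝ, s ≠ 0 → HasDerivAt (fun s => s⁻¹ * cgf X ν s - s / 2 * W)
      (-(s ^ 2)⁻¹ * cgf X ν s + s⁻¹ * deriv (cgf X ν) s - 1 / 2 * W) s := fun s hs => by
    exact ((hasDerivAt_inv hs).mul (hd1 s)).sub (((hasDerivAt_id s).div_const 2).mul_const W)
  have hanti := antitoneOn_of_deriv_nonpos (convex_Ioi (0:ℝ))
    (fun s hs' => (hd s (ne_of_gt hs')).continuousAt.continuousWithinAt)
    (fun s hs' => (hd s (by rw [interior_Ioi] at hs'; exact ne_of_gt hs')).differentiableAt.differentiableWithinAt)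
    (fun s hs' => by
      rw [interior_Ioi] at hs'
      have hs0 : 0 < s := hs'
      rw [(hd s (ne_of_gt hs')).deriv]
      have := h s hs'
      rw [← deriv_cgf (hint s)] at this
      have h3 : -(s ^ 2)⁻¹ * cgf X ν s + s⁻¹ * deriv (cgf X ν) s - 1 / 2 * W =
        (s ^ 2)⁻¹ * (s * deriv (cgf X ν) s - cgf X ν s - s ^ 2 / 2 * W) := by
        field_simp
        ring
      rw [h3]
      exact mul_nonpos_of_nonneg_of_nonpos (by positivity) (by linarith))
  have hlim : Filter.Tendsto (fun s => s⁻¹ * cgf X ν s - s / 2 * W) (nhdsWithin 0 (Set.Ioi 0))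
      (nhds (∫ x, X x ∂ν)) := by
    have h1 := (hd1 0).tendsto_slope_zero_right
    have h2 : Filter.Tendsto (fun s : ℝ => s / 2 * W) (nhdsWithin 0 (Set.Ioi 0)) (nhds 0) := by
      have : Filter.Tendsto (fun s : ℝ => s / 2 * W) (nhds 0) (nhds (0 / 2 * W)) :=
        Continuous.tendsto (by fun_prop) 0
      simpa using this.mono_left nhdsWithin_le_nhds
    rw [deriv_cgf_zero (hint 0)] at h1
    have h3 := h1.sub h2
    simpa using h3
  have hle : s⁻¹ * cgf X ν s - s / 2 * W ≤ ∫ x, X x ∂ν := by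
    refine ge_of_tendsto hlim ?_
    filter_upwards [Ioo_mem_nhdsGT hs] with r hr
    exact hanti hr.1 hs hr.2.le
  have : cgf X ν s = s * (s⁻¹ * cgf X ν s - s / 2 * W) + s ^ 2 / 2 * W := by
    field_simp
    ring
  rw [this]
  gcongr

end Helpers1
section Helpers2

variable {n : ℕ} {Ω : Fin n → Type*} [∀ k, MeasurableSpace (Ω k)]

/-- Bounded measurable. -/
def HBM {α : Type*} [MeasurableSpace α] (g : α → ℝ) : Prop := Measurable g ∧ ∃ b, ∀ x, |g x| ≤ b

/-- Measurable, bounded above and bounded away from zero. -/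
def HPB {α : Type*} [MeasurableSpace α] (g : α → ℝ) : Prop :=
  Measurable g ∧ ∃ a > 0, ∃ b, ∀ x, a ≤ g x ∧ g x ≤ b

lemma HBM.int {α : Type*} [MeasurableSpace α] {g : α → ℝ} (h : HBM g) (ν : Measure α)
    [IsFiniteMeasure ν] : Integrable g ν := by
  obtain ⟨hm, b, hb⟩ := h
  exact h_bdd_int ν hm hb

lemma HBM.mul {α : Type*} [MeasurableSpace α] {g h : α → ℝ} (hg : HBM g) (hh : HBM h) :
    HBM (fun x => g x * h x) := by
  obtain ⟨hm, b, hb⟩ := hg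
  obtain ⟨hm', b', hb'⟩ := hh
  refine ⟨hm.mul hm', b * b', fun x => ?_⟩
  rw [abs_mul]
  exact mul_le_mul (hb x) (hb' x) (abs_nonneg _) ((abs_nonneg _).trans (hb x))

lemma HBM.sub {α : Type*} [MeasurableSpace α] {g h : α → ℝ} (hg : HBM g) (hh : HBM h) :
    HBM (fun x => g x - h x) := by
  obtain ⟨hm, b, hb⟩ := hg
  obtain ⟨hm', b', hb'⟩ := hh
  exact ⟨hm.sub hm', b + b', fun x => (abs_sub _ _).trans (add_le_add (hb x) (hb' x))⟩

lemma HPB.pos {α : Type*} [MeasurableSpace α] {g : α → ℝ} (h : HPB g) (x : α) : 0 < g x := by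
  obtain ⟨hm, a, ha, b, hb⟩ := h
  exact ha.trans_le (hb x).1

lemma HPB.bm {α : Type*} [MeasurableSpace α] {g : α → ℝ} (h : HPB g) : HBM g := by
  have h0 := h.pos
  obtain ⟨hm, a, ha, b, hb⟩ := h
  exact ⟨hm, b, fun x => by rw [abs_of_pos (h0 x)]; exact (hb x).2⟩

lemma HPB.log {α : Type*} [MeasurableSpace α] {g : α → ℝ} (h : HPB g) :
    HBM (fun x => Real.log (g x)) := by
  have h0 := h.pos
  obtain ⟨hm, a, ha, b, hb⟩ := h
  refine ⟨hm.log, |Real.log a| + |Real.log b|, fun x => ?_⟩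
  have h1 := Real.log_le_log ha (hb x).1
  have h2 := Real.log_le_log (h0 x) (hb x).2
  rw [abs_le]
  constructor
  · linarith [neg_abs_le (Real.log a), abs_nonneg (Real.log b)]
  · linarith [le_abs_self (Real.log b), abs_nonneg (Real.log a)]

lemma HPB.inv {α : Type*} [MeasurableSpace α] {g : α → ℝ} (h : HPB g) :
    HBM (fun x => (g x)⁻¹) := by
  have h0 := h.pos
  obtain ⟨hm, a, ha, b, hb⟩ := h
  refine ⟨hm.inv, a⁻¹, fun x => ?_⟩
  rw [abs_of_pos (inv_pos.2 (h0 x))]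
  exact inv_anti₀ ha (hb x).1

variable (μ : ∀ k, Measure (Ω k)) [∀ k, IsProbabilityMeasure (μ k)]

lemma h_fib {g : (∀ i, Ω i) → ℝ} (h : HBM g) (k : Fin n) (x : ∀ i, Ω i) :
    HBM (fun y => g (Function.update x k y)) := by
  obtain ⟨hm, b, hb⟩ := h
  exact ⟨hm.comp (measurable_update x), b, fun y => hb _⟩

lemma h_cond_meas {g : (∀ i, Ω i) → ℝ} (hg : Measurable g) (k : Fin n) :
    Measurable (condExpK μ k g) := by
  have : StronglyMeasurable (fun p : (∀ i, Ω i) × Ω k => g (Function.update p.1 k p.2)) :=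
    (hg.comp measurable_update').stronglyMeasurable
  exact this.integral_prod_right'.measurable

lemma h_cond_bm {g : (∀ i, Ω i) → ℝ} (h : HBM g) (k : Fin n) : HBM (condExpK μ k g) := by
  obtain ⟨hm, b, hb⟩ := h
  refine ⟨h_cond_meas μ hm k, b, fun x => ?_⟩
  have := norm_integral_le_of_norm_le_const (μ := μ k) (f := fun y => g (Function.update x k y))
    (C := b) (Filter.Eventually.of_forall (fun y => hb _))
  simpa [condExpK] using this

lemma h_cond_pb {g : (∀ i, Ω i) → ℝ} (h : HPB g) (k : Fin n) : HPB (condExpK μ k g) := by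
  have hbm := h.bm
  obtain ⟨hm, a, ha, b, hb⟩ := h
  refine ⟨h_cond_meas μ hm k, a, ha, b, fun x => ⟨?_, ?_⟩⟩
  · have := integral_mono (μ := μ k) (integrable_const a) ((h_fib hbm k x).int (μ k))
      (fun y => (hb _).1)
    simpa [condExpK] using this
  · have := integral_mono (μ := μ k) ((h_fib hbm k x).int (μ k)) (integrable_const b)
      (fun y => (hb _).2)
    simpa [condExpK] using this

lemma h_mp (k : Fin n) :
    MeasurePreserving (fun p : (∀ i, Ω i) × Ω k => Function.update p.1 k p.2)
      ((Measure.pi μ).prod (μ k)) (Measure.pi μ) := by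
  refine ⟨measurable_update', (Measure.pi_eq fun s hs => ?_).symm⟩
  rw [Measure.map_apply measurable_update' (MeasurableSet.univ_pi hs)]
  have : (fun p : (∀ i, Ω i) × Ω k => Function.update p.1 k p.2) ⁻¹' (Set.univ.pi s) =
      (Set.univ.pi (Function.update s k Set.univ)) ×ˢ (s k) := by
    ext ⟨x, y⟩
    simp only [Set.mem_preimage, Set.mem_pi, Set.mem_univ, true_imp_iff, Set.mem_prod]
    constructor
    · intro h
      refine ⟨fun i => ?_, by simpa using h k⟩
      by_cases hi : i = k
      · subst hi; simp
      · simpa [hi] using h i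
    · rintro ⟨h, hy⟩ i
      by_cases hi : i = k
      · subst hi; simpa using hy
      · simpa [hi] using h i
  rw [this, Measure.prod_prod, Measure.pi_pi, ← Finset.mul_prod_erase _ _ (Finset.mem_univ k),
    ← Finset.mul_prod_erase _ (fun i => μ i (s i)) (Finset.mem_univ k)]
  simp only [Function.update_self, measure_univ, one_mul]
  rw [mul_comm]
  congr 1
  refine Finset.prod_congr rfl fun i hi => ?_
  rw [Function.update_of_ne (Finset.ne_of_mem_erase hi)]

lemma h_int_cond {g : (∀ i, Ω i) → ℝ} (h : HBM g) (k : Fin n) :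
    ∫ x, condExpK μ k g x ∂(Measure.pi μ) = ∫ x, g x ∂(Measure.pi μ) := by
  have h1 := (h_mp μ k).map_eq
  conv_rhs => rw [← h1]
  rw [integral_map (measurable_update'.aemeasurable) h.1.aestronglyMeasurable, integral_prod]
  · rfl
  · obtain ⟨hm, b, hb⟩ := h
    exact h_bdd_int _ (hm.comp measurable_update') (fun p => hb _)

lemma h_cond_upd (g : (∀ i, Ω i) → ℝ) (k : Fin n) (x : ∀ i, Ω i) (y : Ω k) :
    condExpK μ k g (Function.update x k y) = condExpK μ k g x := by
  simp [condExpK]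

lemma h_cond_upd' (g : (∀ i, Ω i) → ℝ) (j k : Fin n)
    (hg : ∀ x y, g (Function.update x k y) = g x) (x : ∀ i, Ω i) (y : Ω k) :
    condExpK μ j g (Function.update x k y) = condExpK μ j g x := by
  by_cases h : k = j
  · subst h; exact h_cond_upd μ g k x y
  · unfold condExpK
    congr with z
    rw [Function.update_comm h, hg]

/-- Pull out. -/
lemma h_pull {g G : (∀ i, Ω i) → ℝ} (hg : HBM g) (hG : HBM G) (k : Fin n)
    (hGk : ∀ x y, G (Function.update x k y) = G x) :
    ∫ x, condExpK μ k g x * G x ∂(Measure.pi μ) = ∫ x, g x * G x ∂(Measure.pi μ) := by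
  rw [← h_int_cond μ (hg.mul hG) k]
  congr with x
  simp only [condExpK, hGk]
  rw [integral_mul_const]

/-- One step of the tensorization. -/
lemma h_step {Y A : (∀ i, Ω i) → ℝ} (hY : HPB Y) (hA : HPB A) (k : Fin n) :
    ∫ x, Y x * (Real.log (A x) - Real.log (condExpK μ k A x)) ∂(Measure.pi μ) ≤
    ∫ x, Y x * (Real.log (Y x) - Real.log (condExpK μ k Y x)) ∂(Measure.pi μ) := by
  set B := condExpK μ k A with hB
  set Z := condExpK μ k Y with hZ
  have hBp : HPB B := h_cond_pb μ hA k
  have hZp : HPB Z := h_cond_pb μ hY k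
  have key : ∀ x, Y x * (Real.log (A x) - Real.log (B x)) ≤
      Y x * (Real.log (Y x) - Real.log (Z x)) + (A x * (Z x * (B x)⁻¹) - Y x) := by
    intro x
    have a0 := hA.pos x
    have b0 := hBp.pos x
    have z0 := hZp.pos x
    have y0 := hY.pos x
    have hl := Real.log_le_sub_one_of_pos (x := A x * Z x / (B x * Y x)) (by positivity)
    rw [Real.log_div (by positivity) (by positivity), Real.log_mul a0.ne' z0.ne',
      Real.log_mul b0.ne' y0.ne'] at hl
    have h2 := mul_le_mul_of_nonneg_left hl y0.le
    have h3 : Y x * (A x * Z x / (B x * Y x) - 1) = A x * (Z x * (B x)⁻¹) - Y x := by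
      field_simp
    rw [h3] at h2
    linarith
  have hG : HBM (fun x => Z x * (B x)⁻¹) := hZp.bm.mul hBp.inv
  have i1 := (hY.bm.mul (hA.log.sub hBp.log)).int (Measure.pi μ)
  have i2 := (hY.bm.mul (hY.log.sub hZp.log)).int (Measure.pi μ)
  have i3 := (hA.bm.mul hG).int (Measure.pi μ)
  have i4 := hY.bm.int (Measure.pi μ)
  have h1 := integral_mono i1 (i2.add (i3.sub i4)) key
  refine h1.trans (le_of_eq ?_)
  have e1 := h_pull μ hA.bm hG k (fun x y => by simp only [hZ, hB, h_cond_upd])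
  have e2 := h_int_cond μ hY.bm k
  have e3 : ∫ x, condExpK μ k A x * (Z x * (B x)⁻¹) ∂(Measure.pi μ) = ∫ x, Z x ∂(Measure.pi μ) := by
    congr with x
    have b0 := hBp.pos x
    rw [← hB]
    field_simp
  rw [integral_add' i2 (i3.sub i4), integral_sub' i3 i4]
  linarith

/-- Successively integrated function. -/
noncomputable def hIter (Y : (∀ i, Ω i) → ℝ) : ℕ → (∀ i, Ω i) → ℝ
  | 0 => Y
  | j + 1 => if h : j < n then condExpK μ ⟨j, h⟩ (hIter Y j) else hIter Y j

lemma h_iter_pb {Y : (∀ i, Ω i) → ℝ} (hY : HPB Y) (j : ℕ) : HPB (hIter μ Y j) := by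
  induction j with
  | zero => exact hY
  | succ j ih =>
    rw [hIter]
    split_ifs
    · exact h_cond_pb μ ih _
    · exact ih

lemma h_iter_int {Y : (∀ i, Ω i) → ℝ} (hY : HPB Y) (j : ℕ) :
    ∫ x, hIter μ Y j x ∂(Measure.pi μ) = ∫ x, Y x ∂(Measure.pi μ) := by
  induction j with
  | zero => rfl
  | succ j ih =>
    rw [hIter]
    split_ifs
    · rw [h_int_cond μ (h_iter_pb μ hY j).bm, ih]
    · exact ih

lemma h_iter_upd (Y : (∀ i, Ω i) → ℝ) (j : ℕ) (k : Fin n) (hk : k.1 < j) (x : ∀ i, Ω i) (y : Ω k) :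
    hIter μ Y j (Function.update x k y) = hIter μ Y j x := by
  induction j generalizing x y with
  | zero => omega
  | succ j ih =>
    rw [hIter]
    split_ifs with h
    · by_cases hkj : k.1 = j
      · have : k = ⟨j, h⟩ := Fin.ext hkj
        rw [← this]
        exact h_cond_upd μ _ k x y
      · exact h_cond_upd' μ _ _ k (fun x y => ih (by omega) x y) x y
    · exact ih (by omega) x y

lemma h_const {g : (∀ i, Ω i) → ℝ} (hg : ∀ k x y, g (Function.update x k y) = g x)
    (x z : ∀ i, Ω i) : g x = g z := by
  have : ∀ s : Finset (Fin n), g (fun i => if i ∈ s then z i else x i) = g x := by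
    intro s
    induction s using Finset.induction_on with
    | empty => simp
    | insert k s hk ih =>
      rw [← ih, ← hg k (fun i => if i ∈ s then z i else x i) (z k)]
      congr 1
      funext i
      by_cases hi : i = k
      · subst hi; simp
      · simp [hi]
  simpa using (this Finset.univ).symm

lemma h_tensor {Y : (∀ i, Ω i) → ℝ} (hY : HPB Y) :
    ∫ x, Y x * (Real.log (Y x) - Real.log (∫ z, Y z ∂(Measure.pi μ))) ∂(Measure.pi μ) ≤
    ∑ k, ∫ x, Y x * (Real.log (Y x) - Real.log (condExpK μ k Y x)) ∂(Measure.pi μ) := by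
  have hfin : ∀ x, hIter μ Y n x = ∫ z, Y z ∂(Measure.pi μ) := by
    intro x
    rw [← h_iter_int μ hY n]
    have : ∀ z, hIter μ Y n z = hIter μ Y n x := fun z =>
      h_const (fun k x y => h_iter_upd μ Y n k k.2 x y) z x
    simp [this]
  have hb := fun j => (h_iter_pb μ hY j).log
  have htel : ∀ x, Y x * (Real.log (Y x) - Real.log (∫ z, Y z ∂(Measure.pi μ))) =
      ∑ j ∈ Finset.range n,
        Y x * (Real.log (hIter μ Y j x) - Real.log (hIter μ Y (j + 1) x)) := by
    intro x
    rw [← Finset.mul_sum, Finset.sum_range_sub', hfin]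
    rfl
  simp_rw [htel]
  rw [integral_finsetSum _ (fun j _ => (hY.bm.mul ((hb j).sub (hb (j + 1)))).int _),
    Finset.sum_range]
  refine Finset.sum_le_sum fun k _ => ?_
  have := h_step μ hY (h_iter_pb μ hY k.1) k
  simpa [hIter] using this

lemma h_ent {Y : (∀ i, Ω i) → ℝ} (hY : HPB Y) (k : Fin n) :
    HBM (fun x => condExpK μ k (fun z => Y z * Real.log (Y z)) x * (condExpK μ k Y x)⁻¹
        - Real.log (condExpK μ k Y x)) ∧
    ∫ x, Y x * (Real.log (Y x) - Real.log (condExpK μ k Y x)) ∂(Measure.pi μ) =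
    ∫ x, Y x * (condExpK μ k (fun z => Y z * Real.log (Y z)) x * (condExpK μ k Y x)⁻¹
        - Real.log (condExpK μ k Y x)) ∂(Measure.pi μ) := by
  set Z := condExpK μ k Y with hZ
  have hZp : HPB Z := h_cond_pb μ hY k
  have hYl := hY.bm.mul hY.log
  have hU := h_cond_bm μ hYl k
  set U := condExpK μ k (fun z => Y z * Real.log (Y z)) with hUdef
  have hV := hU.mul hZp.inv
  refine ⟨hV.sub hZp.log, ?_⟩
  have e1 := h_int_cond μ hYl k
  have e2 := h_pull μ hY.bm hV k (fun x y => by simp only [hUdef, hZ, h_cond_upd])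
  have e3 : ∫ x, condExpK μ k Y x * (U x * (Z x)⁻¹) ∂(Measure.pi μ) = ∫ x, U x ∂(Measure.pi μ) := by
    congr with x
    have b0 := hZp.pos x
    rw [← hZ]
    field_simp
  simp_rw [mul_sub]
  rw [integral_sub (hYl.int _) ((hY.bm.mul hZp.log).int _),
    integral_sub ((hY.bm.mul hV).int _) ((hY.bm.mul hZp.log).int _)]
  linarith

end Helpers2
section Helpers3

open ProbabilityTheory

variable {n : ℕ} {Ω : Fin n → Type*} [∀ k, MeasurableSpace (Ω k)]

lemma h_exp_pb {α : Type*} [MeasurableSpace α] {X : α → ℝ} (hX : Measurable X) {C : ℝ}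
    (hC : ∀ x, |X x| ≤ C) (s : ℝ) : HPB (fun x => Real.exp (s * X x)) := by
  have h : ∀ x, |s * X x| ≤ |s| * C := fun x => by
    rw [abs_mul]; gcongr; exact hC x
  refine ⟨by fun_prop, Real.exp (-(|s| * C)), Real.exp_pos _, Real.exp (|s| * C), fun x => ?_⟩
  rw [Real.exp_le_exp, Real.exp_le_exp]
  exact abs_le.1 (h x)

lemma h_inf_le {f : (∀ i, Ω i) → ℝ} {C : ℝ} (hC : ∀ x, |f x| ≤ C) (k : Fin n)
    (x : ∀ i, Ω i) (y : Ω k) : condInfK k f x ≤ f (Function.update x k y) := by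
  refine ciInf_le (f := fun y => f (Function.update x k y)) ⟨-C, ?_⟩ y
  rintro _ ⟨z, rfl⟩
  exact (abs_le.1 (hC _)).1

lemma h_inf_upd (f : (∀ i, Ω i) → ℝ) (k : Fin n) (x : ∀ i, Ω i) (y : Ω k) :
    condInfK k f (Function.update x k y) = condInfK k f x := by
  simp [condInfK]

lemma h_inf_abs (μ : ∀ k, Measure (Ω k)) [∀ k, IsProbabilityMeasure (μ k)]
    {f : (∀ i, Ω i) → ℝ} {C : ℝ} (hC : ∀ x, |f x| ≤ C) (k : Fin n)
    (x : ∀ i, Ω i) : |condInfK k f x| ≤ C := by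
  have : Nonempty (Ω k) := (μ k).nonempty_of_neZero
  rw [abs_le]
  constructor
  · exact le_ciInf fun y => (abs_le.1 (hC _)).1
  · exact (h_inf_le hC k x (x k)).trans (abs_le.1 (hC _)).2

lemma h_global (μ : ∀ k, Measure (Ω k)) [∀ k, IsProbabilityMeasure (μ k)]
    {f : (∀ i, Ω i) → ℝ} (hf : Measurable f) {C : ℝ} (hC : ∀ x, |f x| ≤ C) {W : ℝ}
    (hW : ∀ᵐ x ∂(Measure.pi μ), ∑ k,
        condExpK μ k (fun z => (f z - condInfK k f z) ^ 2) x ≤ W) {s : ℝ} (hs : 0 < s) :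
    s * ((∫ x, (-f x) * Real.exp (s * (-f x)) ∂(Measure.pi μ)) /
      mgf (fun x => -f x) (Measure.pi μ) s) - cgf (fun x => -f x) (Measure.pi μ) s
      ≤ s ^ 2 / 2 * W := by
  have hX : Measurable (fun x => -f x) := hf.neg
  have hXC : ∀ x, |(fun x => -f x) x| ≤ C := fun x => by simpa using hC x
  have hY : HPB (fun x => Real.exp (s * (-f x))) := h_exp_pb hX hXC s
  set Y := fun x => Real.exp (s * (-f x)) with hYdef
  set Z := ∫ x, Y x ∂(Measure.pi μ) with hZ
  have hZpos : 0 < Z := by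
    have : Integrable Y (Measure.pi μ) := hY.bm.int _
    exact mgf_pos (X := fun x => -f x) (t := s) this
  have hmgf : mgf (fun x => -f x) (Measure.pi μ) s = Z := rfl
  have hcgf : cgf (fun x => -f x) (Measure.pi μ) s = Real.log Z := rfl
  have ht := h_tensor μ hY
  have hT : ∀ k x, condExpK μ k (fun z => Y z * Real.log (Y z)) x * (condExpK μ k Y x)⁻¹
        - Real.log (condExpK μ k Y x) ≤
        s ^ 2 / 2 * condExpK μ k (fun z => (f z - condInfK k f z) ^ 2) x := by
    intro k x
    have h1 := h_fiber (μ k) (X := fun y => -f (Function.update x k y)) (C := C)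
      (hX.comp (measurable_update x)) (fun y => hXC _) (m := -condInfK k f x)
      (fun y => neg_le_neg (h_inf_le hC k x y)) hs.le
    have e1 : condExpK μ k (fun z => Y z * Real.log (Y z)) x =
        s * ∫ y, (-f (Function.update x k y)) * Real.exp (s * (-f (Function.update x k y))) ∂(μ k) := by
      rw [← integral_const_mul]
      unfold condExpK
      congr with y
      simp only [hYdef, Real.log_exp]
      ring
    have e2 : condExpK μ k (fun z => (f z - condInfK k f z) ^ 2) x =
        ∫ y, (-f (Function.update x k y) - -condInfK k f x) ^ 2 ∂(μ k) := by
      unfold condExpK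
      congr with y
      simp only [h_inf_upd]
      ring
    rw [e1, e2]
    refine le_trans (le_of_eq ?_) h1
    rw [← div_eq_mul_inv, mul_div_assoc]
    rfl
  have hE := fun k => h_ent μ hY k
  simp_rw [fun k => (hE k).2] at ht
  rw [← integral_finsetSum _ (fun k _ => (hY.bm.mul (hE k).1).int _)] at ht
  have hb : ∫ x, ∑ k, Y x * (condExpK μ k (fun z => Y z * Real.log (Y z)) x *
      (condExpK μ k Y x)⁻¹ - Real.log (condExpK μ k Y x)) ∂(Measure.pi μ) ≤
      ∫ x, Y x * (s ^ 2 / 2 * W) ∂(Measure.pi μ) := by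
    refine integral_mono_ae (integrable_finsetSum _ (fun k _ => (hY.bm.mul (hE k).1).int _))
      ((hY.bm.int _).mul_const _) ?_
    filter_upwards [hW] with x hx
    rw [← Finset.mul_sum]
    refine mul_le_mul_of_nonneg_left ?_ (hY.pos x).le
    refine (Finset.sum_le_sum fun k _ => hT k x).trans ?_
    rw [← Finset.mul_sum]
    gcongr
  have ht2 := ht.trans hb
  rw [integral_mul_const, ← hZ] at ht2
  have hl : ∫ x, Y x * (Real.log (Y x) - Real.log Z) ∂(Measure.pi μ) =
      s * (∫ x, (-f x) * Real.exp (s * (-f x)) ∂(Measure.pi μ)) - Z * Real.log Z := by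
    simp_rw [mul_sub]
    rw [integral_sub ((hY.bm.mul hY.log).int _) ((hY.bm.int _).mul_const _), integral_mul_const,
      ← integral_const_mul]
    congr 2
    funext x
    simp only [hYdef, Real.log_exp]
    ring
  rw [hl] at ht2
  rw [hmgf, hcgf, ← sub_nonneg]
  have : s ^ 2 / 2 * W - (s * ((∫ x, (-f x) * Real.exp (s * (-f x)) ∂(Measure.pi μ)) / Z)
      - Real.log Z) = (Z * (s ^ 2 / 2 * W) -
      (s * (∫ x, (-f x) * Real.exp (s * (-f x)) ∂(Measure.pi μ)) - Z * Real.log Z)) / Z := by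
    field_simp
  rw [this]
  exact div_nonneg (by linarith) hZpos.le

end Helpers3

section Statements

variable {n : ℕ} {Ω : Fin n → Type*} [∀ k, MeasurableSpace (Ω k)]

/-- Lower tail bound via conditional second moments. -/
theorem stmt_15 (μ : ∀ k, Measure (Ω k)) [∀ k, IsProbabilityMeasure (μ k)]
    (f : (∀ i, Ω i) → ℝ) (hf : Measurable f) (C : ℝ) (hC : ∀ x, |f x| ≤ C)
    (W : ℝ)
    (hW : W = essSup (fun x => ∑ k,
        condExpK μ k (fun z => (f z - condInfK k f z) ^ 2) x) (Measure.pi μ))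
    (t : ℝ) (ht : 0 < t) :
    ((Measure.pi μ) {x | (∫ y, f y ∂(Measure.pi μ)) - f x > t}).toReal
      ≤ Real.exp (-t ^ 2 / (2 * W)) := by
  have hae : ∀ᵐ x ∂(Measure.pi μ), ∑ k,
      condExpK μ k (fun z => (f z - condInfK k f z) ^ 2) x ≤ W := by
    rw [hW]
    refine ae_le_essSup ?_
    refine Filter.isBoundedUnder_of ⟨∑ k : Fin n, (C + C) ^ 2, fun x => ?_⟩
    show ∑ k, condExpK μ k (fun z => (f z - condInfK k f z) ^ 2) x ≤ ∑ k : Fin n, (C + C) ^ 2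
    refine Finset.sum_le_sum fun k _ => ?_
    have := norm_integral_le_of_norm_le_const (μ := μ k)
      (f := fun y => (f (Function.update x k y) - condInfK k f (Function.update x k y)) ^ 2)
      (C := (C + C) ^ 2) (Filter.Eventually.of_forall (fun y => by
        rw [norm_pow, Real.norm_eq_abs]
        gcongr
        exact (abs_sub _ _).trans (add_le_add (hC _) (h_inf_abs μ hC k _))))
    have h2 := (Real.le_norm_self _).trans this
    simpa [condExpK] using h2
  clear hW
  rcases le_or_gt W 0 with hW0 | hW0
  · refine (measureReal_le_one (μ := Measure.pi μ)).trans ?_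
    apply Real.one_le_exp
    exact div_nonneg_of_nonpos (by nlinarith [sq_nonneg t]) (by linarith)
  · have hX : Measurable (fun x => -f x) := hf.neg
    have hXC : ∀ x, |(fun x => -f x) x| ≤ C := fun x => by simpa using hC x
    have hs : 0 < t / W := by positivity
    have h1 := h_herbst (Measure.pi μ) hX hXC (fun s hs => h_global μ hf hC hae hs) hs
    have h2 := ProbabilityTheory.measure_ge_le_exp_cgf (μ := Measure.pi μ) (X := fun x => -f x)
      (t - ∫ y, f y ∂(Measure.pi μ)) hs.le ((h_exp_pb hX hXC (t / W)).bm.int _)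
    refine (measureReal_mono (μ := Measure.pi μ) ?_).trans (h2.trans ?_)
    · intro x hx
      have hx' : (∫ y, f y ∂(Measure.pi μ)) - f x > t := hx
      show t - (∫ y, f y ∂(Measure.pi μ)) ≤ -f x
      linarith
    · rw [Real.exp_le_exp]
      rw [integral_neg] at h1
      have h3 : -t ^ 2 / (2 * W) = -(t / W) * (t - ∫ y, f y ∂(Measure.pi μ)) +
          (t / W * -(∫ y, f y ∂(Measure.pi μ)) + (t / W) ^ 2 / 2 * W) := by
        field_simp
        ring
      rw [h3]
      linarith

end Statements
end

section
/- Self-bounded lower tail: suppose there are real numbers a ≥ 1 and b ≥ 0 such that Df ≤ a·f + b pointwise, and that f − inf_k f ≤ 1 pointwise for every k ∈ {1,…,n}. Then for every t > 0, μ{x : E[f] − f(x) > t} ≤ exp( −t² / (2(a·E[f] + b)) ). -/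
open MeasureTheory Real

section Statements

variable {n : ℕ} {Ω : Fin n → Type*} [∀ k, MeasurableSpace (Ω k)]

/-- Bounded measurable functions. -/
def BM {α : Type*} [MeasurableSpace α] (F : α → ℝ) : Prop :=
  Measurable F ∧ ∃ B, ∀ x, |F x| ≤ B

namespace BM

variable {α : Type*} [MeasurableSpace α] {F G : α → ℝ}

lemma add (hF : BM F) (hG : BM G) : BM (fun x => F x + G x) := by
  obtain ⟨h1, B, hB⟩ := hF
  obtain ⟨h2, B', hB'⟩ := hG
  exact ⟨h1.add h2, B + B', fun x => (abs_add_le _ _).trans (add_le_add (hB x) (hB' x))⟩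

lemma sub (hF : BM F) (hG : BM G) : BM (fun x => F x - G x) := by
  obtain ⟨h1, B, hB⟩ := hF
  obtain ⟨h2, B', hB'⟩ := hG
  exact ⟨h1.sub h2, B + B', fun x => (abs_sub _ _).trans (add_le_add (hB x) (hB' x))⟩

lemma mul (hF : BM F) (hG : BM G) : BM (fun x => F x * G x) := by
  obtain ⟨h1, B, hB⟩ := hF
  obtain ⟨h2, B', hB'⟩ := hG
  refine ⟨h1.mul h2, B * B', fun x => ?_⟩
  rw [abs_mul]
  exact mul_le_mul (hB x) (hB' x) (abs_nonneg _) ((abs_nonneg _).trans (hB x))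

lemma const (c : ℝ) : BM (fun _ : α => c) := ⟨measurable_const, |c|, fun _ => le_rfl⟩

lemma exp (hF : BM F) : BM (fun x => Real.exp (F x)) := by
  obtain ⟨h1, B, hB⟩ := hF
  refine ⟨h1.exp, Real.exp B, fun x => ?_⟩
  rw [abs_of_pos (Real.exp_pos _)]
  exact Real.exp_le_exp.2 ((le_abs_self _).trans (hB x))

lemma comp {β : Type*} [MeasurableSpace β] (hF : BM F) {T : β → α} (hT : Measurable T) :
    BM (fun x => F (T x)) := by
  obtain ⟨h1, B, hB⟩ := hF
  exact ⟨h1.comp hT, B, fun x => hB _⟩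

lemma int (hF : BM F) (ν : Measure α) [IsFiniteMeasure ν] : Integrable F ν := by
  obtain ⟨h1, B, hB⟩ := hF
  exact Integrable.of_bound h1.aestronglyMeasurable B (Filter.Eventually.of_forall hB)

lemma sum {ι : Type*} (s : Finset ι) {H : ι → α → ℝ} (h : ∀ i, BM (H i)) :
    BM (fun x => ∑ i ∈ s, H i x) := by
  classical
  induction s using Finset.induction_on with
  | empty => simpa using BM.const (α := α) 0
  | insert i s hi ih => simp only [Finset.sum_insert hi]; exact (h i).add ih

end BM

lemma resample (μ : ∀ k, Measure (Ω k)) [∀ k, IsProbabilityMeasure (μ k)] (k : Fin n) :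
    MeasurePreserving (fun p : (∀ i, Ω i) × Ω k => Function.update p.1 k p.2)
      ((Measure.pi μ).prod (μ k)) (Measure.pi μ) := by
  refine ⟨measurable_update', ?_⟩
  symm
  refine Measure.pi_eq fun s hs => ?_
  rw [Measure.map_apply measurable_update' (MeasurableSet.univ_pi hs)]
  have : (fun p : (∀ i, Ω i) × Ω k => Function.update p.1 k p.2) ⁻¹' (Set.univ.pi s)
      = (Set.univ.pi (Function.update s k Set.univ)) ×ˢ (s k) := by
    ext p
    simp only [Set.mem_preimage, Set.mem_pi, Set.mem_univ, true_implies, Set.mem_prod]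
    constructor
    · intro h
      refine ⟨fun i => ?_, by simpa using h k⟩
      by_cases hi : i = k
      · subst hi; simp
      · simpa [hi] using h i
    · rintro ⟨h, h'⟩ i
      by_cases hi : i = k
      · subst hi; simpa using h'
      · simpa [hi] using h i
  rw [this, Measure.prod_prod, Measure.pi_pi, ← Finset.mul_prod_erase _ _ (Finset.mem_univ k),
    ← Finset.mul_prod_erase Finset.univ (fun i => μ i (s i)) (Finset.mem_univ k)]
  simp only [Function.update_self, measure_univ, one_mul]
  rw [mul_comm]
  congr 1
  refine Finset.prod_congr rfl fun i hi => ?_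
  rw [Function.update_of_ne (Finset.ne_of_mem_erase hi)]

lemma integral_resample (μ : ∀ k, Measure (Ω k)) [∀ k, IsProbabilityMeasure (μ k)] (k : Fin n)
    {F : (∀ i, Ω i) → ℝ} (hF : BM F) :
    ∫ x, F x ∂(Measure.pi μ) = ∫ x, ∫ y, F (Function.update x k y) ∂(μ k) ∂(Measure.pi μ) := by
  rw [← (resample μ k).map_eq, integral_map measurable_update'.aemeasurable
    hF.1.aestronglyMeasurable, (resample μ k).map_eq, integral_prod]
  exact (hF.comp measurable_update').int _

/-- log of the conditional expectation of the exponential -/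
noncomputable def softE (μ : ∀ k, Measure (Ω k)) (k : Fin n) (g : (∀ i, Ω i) → ℝ)
    (x : ∀ i, Ω i) : ℝ :=
  Real.log (∫ y, Real.exp (g (Function.update x k y)) ∂(μ k))

lemma BM_upd {g : (∀ i, Ω i) → ℝ} (hg : BM g) (k : Fin n) (x : ∀ i, Ω i) :
    BM (fun y => g (Function.update x k y)) := hg.comp (measurable_update x)

lemma softE_pos (μ : ∀ k, Measure (Ω k)) [∀ k, IsProbabilityMeasure (μ k)] (k : Fin n)
    {g : (∀ i, Ω i) → ℝ} (hg : BM g) (x : ∀ i, Ω i) :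
    0 < ∫ y, Real.exp (g (Function.update x k y)) ∂(μ k) :=
  integral_exp_pos ((BM_upd hg k x).exp.int _)

lemma BM_softE (μ : ∀ k, Measure (Ω k)) [∀ k, IsProbabilityMeasure (μ k)] (k : Fin n)
    {g : (∀ i, Ω i) → ℝ} (hg : BM g) : BM (softE μ k g) := by
  have hm : Measurable (softE μ k g) := by
    refine Real.measurable_log.comp ?_
    have : StronglyMeasurable (fun p : (∀ i, Ω i) × Ω k =>
        Real.exp (g (Function.update p.1 k p.2))) :=
      (hg.1.comp measurable_update').exp.stronglyMeasurable
    exact this.integral_prod_right'.measurable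
  obtain ⟨B, hB⟩ := hg.2
  refine ⟨hm, B, fun x => ?_⟩
  have hp := softE_pos μ k hg x
  have hi := (BM_upd hg k x).exp.int (μ k)
  rw [abs_le]
  constructor
  · rw [softE, Real.le_log_iff_exp_le hp]
    have := integral_mono (μ := μ k) (integrable_const (Real.exp (-B))) hi
      (fun y => Real.exp_le_exp.2 (abs_le.1 (hB _)).1)
    simpa using this
  · rw [softE, Real.log_le_iff_le_exp hp]
    have := integral_mono (μ := μ k) hi (integrable_const (Real.exp (B)))
      (fun y => Real.exp_le_exp.2 (abs_le.1 (hB _)).2)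
    simpa using this

lemma softE_upd_self (μ : ∀ k, Measure (Ω k)) (k : Fin n) (g : (∀ i, Ω i) → ℝ)
    (x : ∀ i, Ω i) (z : Ω k) : softE μ k g (Function.update x k z) = softE μ k g x := by
  simp [softE]

lemma softE_upd (μ : ∀ k, Measure (Ω k)) (k j : Fin n) (g : (∀ i, Ω i) → ℝ)
    (hg : ∀ x z, g (Function.update x j z) = g x)
    (x : ∀ i, Ω i) (z : Ω j) : softE μ k g (Function.update x j z) = softE μ k g x := by
  by_cases h : j = k
  · subst h; exact softE_upd_self _ _ _ _ _
  · unfold softE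
    congr 2
    funext y
    rw [Function.update_comm h, hg]

lemma tensor_step (μ : ∀ k, Measure (Ω k)) [∀ k, IsProbabilityMeasure (μ k)] (k : Fin n)
    {φ g w : (∀ i, Ω i) → ℝ} (hφ : BM φ) (hg : BM g) (hw : BM w)
    (hwk : ∀ x z, w (Function.update x k z) = w x) :
    ∫ x, Real.exp (φ x) * (g x - softE μ k g x) ∂(Measure.pi μ) ≤
      ∫ x, (Real.exp (φ x) * (φ x - w x) + Real.exp (w x) - Real.exp (φ x)) ∂(Measure.pi μ) := by
  have hs := BM_softE μ k hg
  have hkey : ∫ x, Real.exp (w x + g x - softE μ k g x) ∂(Measure.pi μ)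
      = ∫ x, Real.exp (w x) ∂(Measure.pi μ) := by
    rw [integral_resample μ k ((hw.add hg).sub hs).exp]
    congr 1
    funext x
    simp only [softE_upd_self, hwk]
    have : ∀ y, Real.exp (w x + g (Function.update x k y) - softE μ k g x)
        = Real.exp (w x - softE μ k g x) * Real.exp (g (Function.update x k y)) := by
      intro y; rw [← Real.exp_add]; ring_nf
    simp only [this]
    rw [integral_const_mul, Real.exp_sub, softE, Real.exp_log (softE_pos μ k hg x)]
    have := (softE_pos μ k hg x).ne'
    field_simp
  have h1 : ∫ x, (Real.exp (φ x) * (φ x - w x) + Real.exp (w x) - Real.exp (φ x)) ∂(Measure.pi μ)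
      = ∫ x, (Real.exp (φ x) * (φ x - w x) + Real.exp (w x + g x - softE μ k g x)
          - Real.exp (φ x)) ∂(Measure.pi μ) := by
    have hA := (hφ.exp.mul (hφ.sub hw)).int (Measure.pi μ)
    have hW := hw.exp.int (Measure.pi μ)
    have hV := ((hw.add hg).sub hs).exp.int (Measure.pi μ)
    have hP := hφ.exp.int (Measure.pi μ)
    have hAW := ((hφ.exp.mul (hφ.sub hw)).add hw.exp).int (Measure.pi μ)
    have hAV := ((hφ.exp.mul (hφ.sub hw)).add ((hw.add hg).sub hs).exp).int (Measure.pi μ)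
    rw [integral_sub hAW hP, integral_sub hAV hP, integral_add hA hW,
      integral_add hA hV, hkey]
  rw [h1]
  refine integral_mono ((hφ.exp.mul (hg.sub hs)).int _)
    ((((hφ.exp.mul (hφ.sub hw)).add ((hw.add hg).sub hs).exp).sub hφ.exp).int _) fun x => ?_
  have h2 := Real.add_one_le_exp (w x + g x - softE μ k g x - φ x)
  rw [Real.exp_sub, le_div_iff₀ (Real.exp_pos _)] at h2
  dsimp only
  nlinarith [h2]

lemma tensor (μ : ∀ k, Measure (Ω k)) [∀ k, IsProbabilityMeasure (μ k)]
    {φ : (∀ i, Ω i) → ℝ} (hφ : BM φ) {w : Fin n → (∀ i, Ω i) → ℝ} (hw : ∀ k, BM (w k))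
    (hwk : ∀ k x z, w k (Function.update x k z) = w k x) :
    ∫ x, Real.exp (φ x) * φ x ∂(Measure.pi μ)
      - (∫ x, Real.exp (φ x) ∂(Measure.pi μ)) * Real.log (∫ x, Real.exp (φ x) ∂(Measure.pi μ)) ≤
      ∑ k, ∫ x, (Real.exp (φ x) * (φ x - w k x) + Real.exp (w k x) - Real.exp (φ x))
        ∂(Measure.pi μ) := by
  have key : ∀ s : Finset (Fin n), ∃ g : (∀ i, Ω i) → ℝ, BM g ∧
      (∀ j ∈ s, ∀ x z, g (Function.update x j z) = g x) ∧
      ∫ x, Real.exp (g x) ∂(Measure.pi μ) = ∫ x, Real.exp (φ x) ∂(Measure.pi μ) ∧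
      ∫ x, Real.exp (φ x) * (φ x - g x) ∂(Measure.pi μ) ≤
      ∑ k ∈ s, ∫ x, (Real.exp (φ x) * (φ x - w k x) + Real.exp (w k x) - Real.exp (φ x))
        ∂(Measure.pi μ) := by
    intro s
    induction s using Finset.induction_on with
    | empty => exact ⟨φ, hφ, by simp, rfl, by simp⟩
    | insert k s hk ih =>
      obtain ⟨g, hg, hgs, hgi, hgb⟩ := ih
      have hs := BM_softE μ k hg
      refine ⟨softE μ k g, hs, ?_, ?_, ?_⟩
      · intro j hj
        rcases Finset.mem_insert.1 hj with rfl | hj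
        · exact softE_upd_self _ _ _
        · exact softE_upd _ _ _ _ (hgs j hj)
      · rw [← hgi, integral_resample μ k hg.exp]
        congr 1
        funext x
        rw [softE, Real.exp_log (softE_pos μ k hg x)]
      · rw [Finset.sum_insert hk]
        have h1 := tensor_step μ k hφ hg (hw k) (hwk k)
        have h2 : ∫ x, Real.exp (φ x) * (φ x - softE μ k g x) ∂(Measure.pi μ)
            = ∫ x, Real.exp (φ x) * (g x - softE μ k g x) ∂(Measure.pi μ)
              + ∫ x, Real.exp (φ x) * (φ x - g x) ∂(Measure.pi μ) := by
          rw [← integral_add ((hφ.exp.mul (hg.sub hs)).int _) ((hφ.exp.mul (hφ.sub hg)).int _)]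
          congr 1
          funext x
          ring
        linarith
  obtain ⟨g, hg, hgs, hgi, hgb⟩ := key Finset.univ
  have hconst : ∀ x x', g x' = g x := by
    intro x x'
    have : ∀ s : Finset (Fin n), g (s.piecewise x' x) = g x := by
      intro s
      induction s using Finset.induction_on with
      | empty => simp
      | insert k s hk ih => rw [Finset.piecewise_insert, hgs k (Finset.mem_univ _), ih]
    simpa using this Finset.univ
  have hne : ∃ x : (∀ i, Ω i), True :=
    ⟨fun i => ((μ i).nonempty_of_neZero).some, trivial⟩
  obtain ⟨x0, -⟩ := hne
  have hgc : ∀ x, g x = g x0 := fun x => hconst x0 x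
  simp only [hgc] at hgi hgb
  have hZ : Real.log (∫ x, Real.exp (φ x) ∂(Measure.pi μ)) = g x0 := by
    rw [← hgi]; simp
  rw [hZ]
  refine le_trans (le_of_eq ?_) hgb
  simp only [mul_sub]
  rw [integral_sub ((hφ.exp.mul hφ).int _) (hφ.exp.int _ |>.mul_const _), integral_mul_const]

lemma psi_scale (l d : ℝ) (hl : 0 ≤ l) (hd0 : 0 ≤ d) (hd1 : d ≤ 1) :
    Real.exp (l * d) - 1 - l * d ≤ d ^ 2 * (Real.exp l - 1 - l) := by
  have hder : ∀ x : ℝ, HasDerivAt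
      (fun x => d ^ 2 * (Real.exp x - 1 - x) - (Real.exp (x * d) - 1 - x * d))
      (d ^ 2 * (Real.exp x - 1) - (Real.exp (x * d) * d - d)) x := by
    intro x
    have h1 : HasDerivAt (fun x : ℝ => x * d) d x := by
      simpa using (hasDerivAt_id x).mul_const d
    have h2 := ((((Real.hasDerivAt_exp x).sub_const 1).sub (hasDerivAt_id x)).const_mul (d ^ 2)).sub
      ((h1.exp.sub_const 1).sub h1)
    exact h2
  have hm : MonotoneOn
      (fun x => d ^ 2 * (Real.exp x - 1 - x) - (Real.exp (x * d) - 1 - x * d)) (Set.Ici 0) := by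
    apply monotoneOn_of_deriv_nonneg (convex_Ici 0)
    · exact fun x _ => (hder x).continuousAt.continuousWithinAt
    · exact fun x _ => (hder x).differentiableAt.differentiableWithinAt
    · intro x _
      rw [(hder x).deriv]
      have hc := convexOn_exp.2 (Set.mem_univ x) (Set.mem_univ 0) hd0 (sub_nonneg.2 hd1)
        (by ring)
      simp only [smul_eq_mul, mul_zero, add_zero, Real.exp_zero, mul_one] at hc
      rw [mul_comm d x] at hc
      nlinarith [mul_nonneg hd0 (sub_nonneg.2 hc)]
  have := hm (Set.mem_Ici.2 le_rfl) (Set.mem_Ici.2 hl) hl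
  simp at this
  linarith

lemma psi_ineq (l : ℝ) (hl : 0 ≤ l) :
    0 ≤ l ^ 2 / 2 + (l - 1) * (Real.exp l - 1 - l) := by
  have hder : ∀ x : ℝ, HasDerivAt (fun l : ℝ => l ^ 2 / 2 + (l - 1) * (Real.exp l - 1 - l))
      (x * Real.exp x - x) x := by
    intro x
    have h2 := (((hasDerivAt_id x).pow 2).div_const 2).add
      (((hasDerivAt_id x).sub_const 1).mul
        (((Real.hasDerivAt_exp x).sub_const 1).sub (hasDerivAt_id x)))
    convert! h2 using 1
    simp
    ring
  have hm : MonotoneOn (fun l : ℝ => l ^ 2 / 2 + (l - 1) * (Real.exp l - 1 - l)) (Set.Ici 0) := by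
    apply monotoneOn_of_deriv_nonneg (convex_Ici 0)
    · exact fun x _ => (hder x).continuousAt.continuousWithinAt
    · exact fun x _ => (hder x).differentiableAt.differentiableWithinAt
    · intro x hx
      rw [interior_Ici] at hx
      have hx : 0 < x := hx
      rw [(hder x).deriv]
      nlinarith [Real.one_le_exp hx.le]
  have := hm (Set.mem_Ici.2 le_rfl) (Set.mem_Ici.2 hl) hl
  simpa using this

lemma ode_bound (G G' : ℝ → ℝ) (hG : ∀ l, HasDerivAt G (G' l) l) (h0 : G 0 = 0) (h0' : G' 0 = 0)
    (a v : ℝ) (ha : 1 ≤ a) (hv : 0 ≤ v) (hpos : ∀ l, 0 < l → 0 ≤ G' l)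
    (hode : ∀ l, 0 < l →
      l * G' l - G l ≤ (Real.exp l - 1 - l) * (v - a * G' l)) (l : ℝ) (hl : 0 < l) :
    G l ≤ v * l ^ 2 / 2 := by
  let D : ℝ → ℝ := fun l => G l - v * l ^ 2 / 2
  let q : ℝ → ℝ := fun l => D l / (1 - Real.exp (-l))
  have hD : ∀ x, HasDerivAt D (G' x - v * x) x := by
    intro x
    have h2 := (hG x).sub ((((hasDerivAt_id x).pow 2).const_mul v).div_const 2)
    convert! h2 using 1
    simp
    ring
  have hE : ∀ x : ℝ, HasDerivAt (fun x : ℝ => 1 - Real.exp (-x)) (Real.exp (-x)) x := by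
    intro x
    have h2 := ((hasDerivAt_id x).neg.exp).const_sub 1
    convert! h2 using 1
    simp
  have hEpos : ∀ x : ℝ, 0 < x → 0 < 1 - Real.exp (-x) := by
    intro x hx
    have : Real.exp (-x) < 1 := by rw [Real.exp_lt_one_iff]; linarith
    linarith
  have hq : ∀ x, 0 < x → HasDerivAt q
      (((G' x - v * x) * (1 - Real.exp (-x)) - D x * Real.exp (-x)) / (1 - Real.exp (-x)) ^ 2) x :=
    fun x hx => (hD x).div (hE x) (hEpos x hx).ne'
  have hanti : AntitoneOn q (Set.Ioi 0) := by
    apply antitoneOn_of_deriv_nonpos (convex_Ioi 0)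
    · exact fun x hx => (hq x hx).continuousAt.continuousWithinAt
    · intro x hx
      rw [interior_Ioi] at hx
      exact (hq x hx).differentiableAt.differentiableWithinAt
    · intro x hx
      rw [interior_Ioi] at hx
      have hx : 0 < x := hx
      rw [(hq x hx).deriv]
      apply div_nonpos_of_nonpos_of_nonneg _ (sq_nonneg _)
      have e1 : (1 - Real.exp (-x)) = Real.exp (-x) * (Real.exp x - 1) := by
        rw [mul_sub, ← Real.exp_add]; simp
      have e2 : (Real.exp x - 1) * (G' x - v * x) - D x ≤ 0 := by
        have i1 := hode x hx
        have i2 := hpos x hx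
        have i3 := psi_ineq x hx.le
        have i4 : 0 ≤ Real.exp x - 1 - x := by linarith [Real.add_one_le_exp x]
        have i5 : 0 ≤ (a - 1) * ((Real.exp x - 1 - x) * G' x) :=
          mul_nonneg (by linarith) (mul_nonneg i4 i2)
        have i6 := mul_nonneg hv i3
        simp only [D]
        nlinarith
      rw [e1]
      have := Real.exp_pos (-x)
      nlinarith
  have hlim : Filter.Tendsto q (nhdsWithin 0 (Set.Ioi 0)) (nhds 0) := by
    have t1 := (hD 0).tendsto_slope.mono_left
      (nhdsWithin_mono 0 (fun x (hx : x ∈ Set.Ioi (0 : ℝ)) => (ne_of_gt hx : x ∈ ({0}ᶜ : Set ℝ))))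
    have t2 := (hE 0).tendsto_slope.mono_left
      (nhdsWithin_mono 0 (fun x (hx : x ∈ Set.Ioi (0 : ℝ)) => (ne_of_gt hx : x ∈ ({0}ᶜ : Set ℝ))))
    have t3 := t1.div t2 (by simp)
    simp only [h0', mul_zero, sub_zero, zero_div] at t3
    refine t3.congr' ?_
    filter_upwards [self_mem_nhdsWithin] with x hx
    have hx : 0 < x := hx
    have := (hEpos x hx).ne'
    simp only [Pi.div_apply, slope_def_field, q, D, h0]
    simp
    field_simp
  have hq0 : q l ≤ 0 := by
    refine ge_of_tendsto hlim ?_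
    filter_upwards [Ioo_mem_nhdsGT hl] with x hx
    exact hanti hx.1 hl hx.2.le
  have := (div_le_iff₀ (hEpos l hl)).1 hq0
  simp only [D, zero_mul] at this
  linarith

/-- conditional essential infimum (measurable version) -/
noncomputable def essI (μ : ∀ k, Measure (Ω k)) (C : ℝ) (k : Fin n) (f : (∀ i, Ω i) → ℝ)
    (x : ∀ i, Ω i) : ℝ :=
  open Classical in
  ⨆ q : ℚ, if μ k {y | f (Function.update x k y) < q} = 0 then (q : ℝ) else -C

lemma essI_term_le (μ : ∀ k, Measure (Ω k)) [∀ k, IsProbabilityMeasure (μ k)]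
    (f : (∀ i, Ω i) → ℝ) (C : ℝ) (hC : ∀ x, |f x| ≤ C) (k : Fin n) (x : ∀ i, Ω i) (q : ℚ) :
    (open Classical in
    if μ k {y | f (Function.update x k y) < q} = 0 then (q : ℝ) else -C) ≤ C := by
  have hC0 : 0 ≤ C := (abs_nonneg _).trans (hC x)
  split_ifs with h
  · by_contra hq
    push Not at hq
    have : {y | f (Function.update x k y) < q} = Set.univ := by
      ext y
      simp only [Set.mem_ofPred_eq, Set.mem_univ, iff_true]
      exact ((le_abs_self _).trans (hC _)).trans_lt hq
    rw [this] at h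
    simp at h
  · linarith

lemma essI_bdd (μ : ∀ k, Measure (Ω k)) [∀ k, IsProbabilityMeasure (μ k)]
    (f : (∀ i, Ω i) → ℝ) (C : ℝ) (hC : ∀ x, |f x| ≤ C) (k : Fin n) (x : ∀ i, Ω i) : BddAbove (Set.range fun q : ℚ =>
    (open Classical in
    if μ k {y | f (Function.update x k y) < q} = 0 then (q : ℝ) else -C)) :=
  ⟨C, by rintro _ ⟨q, rfl⟩; exact essI_term_le μ f C hC k x q⟩

lemma essI_le (μ : ∀ k, Measure (Ω k)) [∀ k, IsProbabilityMeasure (μ k)]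
    (f : (∀ i, Ω i) → ℝ) (C : ℝ) (hC : ∀ x, |f x| ≤ C) (k : Fin n) (x : ∀ i, Ω i) : essI μ C k f x ≤ C :=
  ciSup_le fun q => essI_term_le μ f C hC k x q

lemma inf_le_essI (μ : ∀ k, Measure (Ω k)) [∀ k, IsProbabilityMeasure (μ k)]
    (f : (∀ i, Ω i) → ℝ) (C : ℝ) (hC : ∀ x, |f x| ≤ C) (k : Fin n) (x : ∀ i, Ω i) : condInfK k f x ≤ essI μ C k f x := by
  refine le_of_forall_rat_lt_imp_le fun q hq => ?_
  refine le_trans ?_ (le_ciSup (essI_bdd μ f C hC k x) q)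
  have : {y | f (Function.update x k y) < q} = ∅ := by
    ext y
    simp only [Set.mem_ofPred_eq, Set.mem_empty_iff_false, iff_false, not_lt]
    refine hq.le.trans (ciInf_le ⟨-C, ?_⟩ y)
    rintro _ ⟨z, rfl⟩
    exact (abs_le.1 (hC _)).1
  simp [this]

lemma BM_essI (μ : ∀ k, Measure (Ω k)) [∀ k, IsProbabilityMeasure (μ k)]
    (f : (∀ i, Ω i) → ℝ) (hf : Measurable f) (C : ℝ) (hC : ∀ x, |f x| ≤ C) (k : Fin n) : BM (essI μ C k f) := by
  refine ⟨?_, C, fun x => abs_le.2 ⟨?_, essI_le μ f C hC k x⟩⟩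
  · refine Measurable.iSup fun q => ?_
    refine Measurable.ite ?_ measurable_const measurable_const
    have hs : MeasurableSet {p : (∀ i, Ω i) × Ω k | f (Function.update p.1 k p.2) < q} :=
      measurableSet_lt (hf.comp measurable_update') measurable_const
    exact (measurable_measure_prodMk_left (ν := μ k) hs) (measurableSet_singleton 0)
  · refine le_trans ?_ (inf_le_essI μ f C hC k x)
    have : Nonempty (Ω k) := (μ k).nonempty_of_neZero
    exact le_ciInf fun y => (abs_le.1 (hC _)).1

lemma essI_upd (μ : ∀ k, Measure (Ω k)) (f : (∀ i, Ω i) → ℝ) (C : ℝ) (k : Fin n)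
    (x : ∀ i, Ω i) (z : Ω k) :
    essI μ C k f (Function.update x k z) = essI μ C k f x := by
  simp [essI]

lemma essI_ae (μ : ∀ k, Measure (Ω k)) [∀ k, IsProbabilityMeasure (μ k)]
    (f : (∀ i, Ω i) → ℝ) (hf : Measurable f) (C : ℝ) (hC : ∀ x, |f x| ≤ C) (k : Fin n) : ∀ᵐ x ∂(Measure.pi μ), essI μ C k f x ≤ f x := by
  have hm := (BM_essI μ f hf C hC k).1
  have hs : MeasurableSet {x | essI μ C k f x ≤ f x} := measurableSet_le hm hf
  rw [← (resample μ k).map_eq, ae_map_iff measurable_update'.aemeasurable hs]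
  refine (Measure.ae_prod_iff_ae_ae (p := fun p : (∀ i, Ω i) × Ω k =>
    essI μ C k f (Function.update p.1 k p.2) ≤ f (Function.update p.1 k p.2))
    (measurable_update' hs)).2 ?_
  refine Filter.Eventually.of_forall fun x => ?_
  simp only [essI_upd]
  have : ∀ q : ℚ, ∀ᵐ y ∂(μ k),
      (open Classical in
    if μ k {y | f (Function.update x k y) < q} = 0 then (q : ℝ) else -C)
        ≤ f (Function.update x k y) := by
    intro q
    split_ifs with h
    · rw [ae_iff]; simpa using h
    · exact Filter.Eventually.of_forall fun y => (abs_le.1 (hC _)).1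
  filter_upwards [ae_all_iff.2 this] with y hy
  exact ciSup_le hy

/-- Self-bounded lower tail. -/
theorem stmt_19 (μ : ∀ k, Measure (Ω k)) [∀ k, IsProbabilityMeasure (μ k)]
    (f : (∀ i, Ω i) → ℝ) (hf : Measurable f) (C : ℝ) (hC : ∀ x, |f x| ≤ C)
    (a b : ℝ) (ha : 1 ≤ a) (hb : 0 ≤ b)
    (hself : ∀ x, Dproxy f x ≤ a * f x + b)
    (h1 : ∀ k x, f x - condInfK k f x ≤ 1)
    (t : ℝ) (ht : 0 < t) :
    ((Measure.pi μ) {x | (∫ y, f y ∂(Measure.pi μ)) - f x > t}).toReal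
      ≤ Real.exp (-t ^ 2 / (2 * (a * ∫ y, f y ∂(Measure.pi μ) + b))) := by
  classical
  set P := Measure.pi μ with hP
  set m := ∫ y, f y ∂P with hm
  set v := a * m + b with hv
  have hfB : BM f := ⟨hf, C, hC⟩
  have hmid : ∫ y, (a * f y + b) ∂P = v := by
    rw [integral_add ((hfB.int P).const_mul a) (integrable_const b), integral_const_mul]
    simp [hv, hm]
  have hv0 : 0 ≤ v := by
    rw [← hmid]
    refine integral_nonneg fun x => le_trans ?_ (hself x)
    exact Finset.sum_nonneg fun k _ => sq_nonneg _
  rcases hv0.eq_or_lt with hv0' | hvpos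
  · rw [← hv0']
    simp only [mul_zero, div_zero, Real.exp_zero]
    exact measureReal_le_one
  let h : (∀ i, Ω i) → ℝ := fun x => m - f x
  have hh : BM h := (BM.const m).sub hfB
  have hl : ∀ l : ℝ, BM (fun x => l * h x) := fun l => (BM.const l).mul hh
  have hset : ProbabilityTheory.integrableExpSet h P = Set.univ := by
    ext l
    simp only [Set.mem_univ, iff_true]
    exact (hl l).exp.int P
  have hmem : ∀ l, l ∈ interior (ProbabilityTheory.integrableExpSet h P) := by
    intro l; rw [hset]; simp
  have hmgf : ∀ l, 0 < ProbabilityTheory.mgf h P l := fun l =>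
    ProbabilityTheory.mgf_pos ((hl l).exp.int P)
  have hcen : ∫ x, h x ∂P = 0 := by
    simp only [h]
    rw [integral_sub (integrable_const m) (hfB.int P)]
    simp [hm]
  let N : ℝ → ℝ := fun l => ∫ x, h x * Real.exp (l * h x) ∂P
  have hNpos : ∀ l, 0 < l → 0 ≤ N l := by
    intro l hl0
    rw [← hcen]
    refine integral_mono (hh.int P) ((hh.mul (hl l).exp).int P) fun x => ?_
    dsimp only
    rcases le_total 0 (h x) with hx | hx
    · nlinarith [Real.one_le_exp (mul_nonneg hl0.le hx)]
    · have : Real.exp (l * h x) ≤ 1 := by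
        rw [Real.exp_le_one_iff]; exact mul_nonpos_of_nonneg_of_nonpos hl0.le hx
      nlinarith
  have hent : ∀ l, 0 < l → l * N l - ProbabilityTheory.mgf h P l *
      Real.log (ProbabilityTheory.mgf h P l) ≤
      (Real.exp l - 1 - l) * (v * ProbabilityTheory.mgf h P l - a * N l) := by
    intro l hl0
    have hψ : 0 ≤ Real.exp l - 1 - l := by linarith [Real.add_one_le_exp l]
    have hi : ∀ k, BM (essI μ C k f) := fun k => BM_essI μ f hf C hC k
    have ht := tensor μ (hl l) (w := fun k x => l * (m - essI μ C k f x))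
      (fun k => (BM.const l).mul ((BM.const m).sub (hi k)))
      (fun k x z => by simp only [essI_upd])
    have e1 : ∫ x, Real.exp (l * h x) * (l * h x) ∂P = l * N l := by
      rw [← integral_const_mul]
      congr 1
      funext x
      ring
    rw [← hP, e1] at ht
    refine le_trans ht ?_
    have hdB : ∀ k, BM (fun x => Real.exp (l * h x) * (Real.exp l - 1 - l) *
        ((f x - essI μ C k f x) * (f x - essI μ C k f x))) := fun k =>
      ((hl l).exp.mul (BM.const _)).mul ((hfB.sub (hi k)).mul (hfB.sub (hi k)))
    have hae : ∀ᵐ x ∂P, ∀ k, essI μ C k f x ≤ f x :=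
      ae_all_iff.2 fun k => essI_ae μ f hf C hC k
    calc ∑ k, ∫ x, (Real.exp (l * h x) * (l * h x - l * (m - essI μ C k f x))
            + Real.exp (l * (m - essI μ C k f x)) - Real.exp (l * h x)) ∂P
        ≤ ∑ k, ∫ x, Real.exp (l * h x) * (Real.exp l - 1 - l) *
            ((f x - essI μ C k f x) * (f x - essI μ C k f x)) ∂P := by
          refine Finset.sum_le_sum fun k _ => ?_
          refine integral_mono_ae (BM.int ?_ P) ((hdB k).int P) ?_
          · exact (((hl l).exp.mul ((hl l).sub ((BM.const l).mul ((BM.const m).sub (hi k))))).add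
              ((BM.const l).mul ((BM.const m).sub (hi k))).exp).sub (hl l).exp
          · filter_upwards [hae] with x hx
            have hd1 : f x - essI μ C k f x ≤ 1 := by
              linarith [h1 k x, inf_le_essI μ f C hC k x]
            have hp := psi_scale l (f x - essI μ C k f x) hl0.le (sub_nonneg.2 (hx k)) hd1
            have e2 : Real.exp (l * (m - essI μ C k f x))
                = Real.exp (l * h x) * Real.exp (l * (f x - essI μ C k f x)) := by
              rw [← Real.exp_add]; simp only [h]; ring_nf
            rw [e2]
            have := mul_le_mul_of_nonneg_left hp (Real.exp_pos (l * h x)).le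
            simp only [h] at this ⊢
            nlinarith
      _ = ∫ x, ∑ k, Real.exp (l * h x) * (Real.exp l - 1 - l) *
            ((f x - essI μ C k f x) * (f x - essI μ C k f x)) ∂P :=
          (integral_finsetSum _ fun k _ => (hdB k).int P).symm
      _ ≤ ∫ x, (Real.exp l - 1 - l) * (v * Real.exp (l * h x)
            - a * (h x * Real.exp (l * h x))) ∂P := by
          refine integral_mono_ae ((BM.sum _ hdB).int P) (BM.int ?_ P) ?_
          · exact (BM.const _).mul (((BM.const v).mul (hl l).exp).sub
              ((BM.const a).mul (hh.mul (hl l).exp)))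
          · filter_upwards [hae] with x hx
            rw [← Finset.mul_sum]
            have hs : ∑ k, (f x - essI μ C k f x) * (f x - essI μ C k f x) ≤ a * f x + b := by
              refine le_trans (Finset.sum_le_sum fun k _ => ?_) (hself x)
              rw [← sq]
              exact pow_le_pow_left₀ (sub_nonneg.2 (hx k))
                (by linarith [inf_le_essI μ f C hC k x]) 2
            have := mul_le_mul_of_nonneg_left hs
              (mul_nonneg (Real.exp_pos (l * h x)).le hψ)
            refine this.trans (le_of_eq ?_)
            simp only [h, hv]
            ring
      _ = _ := by
          rw [integral_const_mul, integral_sub (((hl l).exp.int P).const_mul v)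
            (((hh.mul (hl l).exp).int P).const_mul a), integral_const_mul, integral_const_mul]
          rfl
  have hG : ∀ l, HasDerivAt (ProbabilityTheory.cgf h P) (N l / ProbabilityTheory.mgf h P l) l := by
    intro l
    exact (ProbabilityTheory.hasDerivAt_mgf (hmem l)).log (hmgf l).ne'
  have hbound := ode_bound (ProbabilityTheory.cgf h P)
    (fun l => N l / ProbabilityTheory.mgf h P l) hG (by simp) (by simp [N, hcen]) a v ha hv0
    (fun l hl0 => div_nonneg (hNpos l hl0) (hmgf l).le)
    (fun l hl0 => by
      have hp := hmgf l
      have := (div_le_div_iff_of_pos_right hp).2 (hent l hl0)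
      refine le_trans (le_of_eq ?_) (this.trans (le_of_eq ?_))
      · simp only [ProbabilityTheory.cgf]
        field_simp
      · field_simp)
    (t / v) (div_pos ht hvpos)
  have hch := ProbabilityTheory.measure_ge_le_exp_cgf (μ := P) (X := h) t (div_pos ht hvpos).le
    ((hl (t / v)).exp.int P)
  calc (P {x | m - f x > t}).toReal ≤ P.real {x | t ≤ h x} :=
        measureReal_mono (Set.ofPred_subset_ofPred.2 fun x hx => le_of_lt hx)
    _ ≤ _ := hch
    _ ≤ _ := by
        refine Real.exp_le_exp.2 ?_
        have e : -t ^ 2 / (2 * v) = -(t / v) * t + v * (t / v) ^ 2 / 2 := by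
          field_simp
          ring
        linarith

end Statements
end
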